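/- Let 𝓗 be a complex Hilbert space, H : ℝ → B(𝓗) norm-continuous, and U the Cauchy evolution generated by H, and assume sup_{t,s ∈ ℝ}‖U(t,s)‖ < ∞. Let π ∈ B(𝓗) satisfy π² = π, and suppose there are C ≥ 0 and δ > 0 such that ‖[H(t), π]‖ ≤ C·⟨t⟩^{−1−δ} for all t ∈ ℝ. Then the limit lim_{t→+∞} U(0,t)·π·U(t,0) exists in operator norm; it equals π − i·∫₀^∞ U(0,t)·[H(t),π]·U(t,0) dt (a Bochner integral convergent in operator norm), and the limit operator is idempotent. -/

import Mathlib

open MeasureTheory Filter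

/-- Two-parameter families solving both Cauchy equations satisfy the Chapman-Kolmogorov law. -/
theorem cauchyEvolution_mul {A : Type*} [NormedRing A] [NormedAlgebra ℂ A]
    {H : ℝ → A} {U : ℝ → ℝ → A} (hU1 : ∀ t, U t t = 1)
    (hU2 : ∀ s t, HasDerivAt (fun τ => U τ s) (Complex.I • (H t * U t s)) t)
    (hU3 : ∀ t s, HasDerivAt (fun σ => U t σ) (-(Complex.I • (U t s * H s))) s)
    (t r s : ℝ) : U t r * U r s = U t s := by
  have hd : ∀ σ, HasDerivAt (fun σ => U t σ * U σ s) 0 σ := fun σ => by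
    refine ((hU3 t σ).mul (hU2 s σ)).congr_deriv ?_
    simp [mul_assoc]
  have h := is_const_of_deriv_eq_zero (fun σ => (hd σ).differentiableAt)
    (fun σ => (hd σ).deriv) r s
  simpa [hU1] using h

/-- Let `U` be the Cauchy evolution generated by a norm-continuous
`H : ℝ → B(𝓗)` with `sup_{t,s}‖U(t,s)‖ < ∞`, and let `p ∈ B(𝓗)` be an idempotent
with `‖[H(t), p]‖ ≤ C·⟨t⟩^(−1−δ)`, `C ≥ 0`, `δ > 0`. Then `lim_{t→+∞} U(0,t)·p·U(t,0)`
exists in operator norm, it equals `p − i·∫₀^∞ U(0,t)·[H(t),p]·U(t,0) dt` (a Bochner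
integral convergent in operator norm), and the limit operator is idempotent. -/
theorem stmt4 {𝓗 : Type*} [NormedAddCommGroup 𝓗] [InnerProductSpace ℂ 𝓗] [CompleteSpace 𝓗]
    (H : ℝ → (𝓗 →L[ℂ] 𝓗)) (hH : Continuous H)
    (U : ℝ → ℝ → (𝓗 →L[ℂ] 𝓗))
    (hU1 : ∀ t, U t t = 1)
    (hU2 : ∀ s t, HasDerivAt (fun τ => U τ s) (Complex.I • (H t * U t s)) t)
    (hU3 : ∀ t s, HasDerivAt (fun σ => U t σ) (-(Complex.I • (U t s * H s))) s)
    (hM : ∃ M : ℝ, ∀ t s, ‖U t s‖ ≤ M)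
    (p : 𝓗 →L[ℂ] 𝓗) (hp : p * p = p)
    (C δ : ℝ) (hC : 0 ≤ C) (hδ : 0 < δ)
    (hcomm : ∀ t, ‖H t * p - p * H t‖ ≤ C * (1 + t ^ 2) ^ (-(1 + δ) / 2 : ℝ)) :
    IntegrableOn (fun t => U 0 t * (H t * p - p * H t) * U t 0) (Set.Ioi (0 : ℝ)) ∧
    ∃ L : 𝓗 →L[ℂ] 𝓗,
      Tendsto (fun t => U 0 t * p * U t 0) atTop (nhds L) ∧
      L = p - Complex.I • ∫ t in Set.Ioi (0 : ℝ), U 0 t * (H t * p - p * H t) * U t 0 ∧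
      L * L = L := by
  obtain ⟨M, hM⟩ := hM
  have hM0 : 0 ≤ M := (norm_nonneg _).trans (hM 0 0)
  have hc1 : Continuous fun t => U 0 t :=
    continuous_iff_continuousAt.2 fun t => (hU3 0 t).continuousAt
  have hc2 : Continuous fun t => U t 0 :=
    continuous_iff_continuousAt.2 fun t => (hU2 0 t).continuousAt
  have hc : Continuous fun t => U 0 t * (H t * p - p * H t) * U t 0 := by fun_prop
  have hbound : Integrable fun t : ℝ => M * (C * (1 + t ^ 2) ^ (-(1 + δ) / 2 : ℝ)) * M := by
    have h := integrable_rpow_neg_one_add_norm_sq (E := ℝ) (μ := volume) (r := 1 + δ)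
      (by simpa using hδ)
    simp only [Real.norm_eq_abs, sq_abs] at h
    exact (h.const_mul C).const_mul M |>.mul_const M
  have hintegrable : Integrable fun t => U 0 t * (H t * p - p * H t) * U t 0 := by
    refine hbound.mono' hc.aestronglyMeasurable (Eventually.of_forall fun t => ?_)
    calc ‖U 0 t * (H t * p - p * H t) * U t 0‖
        ≤ ‖U 0 t‖ * ‖H t * p - p * H t‖ * ‖U t 0‖ := norm_mul₃_le
      _ ≤ M * (C * (1 + t ^ 2) ^ (-(1 + δ) / 2 : ℝ)) * M := by
        gcongr
        exacts [hM _ _, hcomm t, hM _ _]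
  have hderiv : ∀ t, HasDerivAt (fun t => U 0 t * p * U t 0)
      (-(Complex.I • (U 0 t * (H t * p - p * H t) * U t 0))) t := fun t => by
    refine (((hU3 0 t).mul_const p).mul (hU2 0 t)).congr_deriv ?_
    simp only [mul_sub, sub_mul, mul_assoc, smul_mul_assoc, mul_smul_comm, neg_mul, smul_sub]
    abel
  have hderivInt : IntegrableOn
      (fun t => -(Complex.I • (U 0 t * (H t * p - p * H t) * U t 0))) (Set.Ioi (0 : ℝ)) :=
    (hintegrable.integrableOn.smul Complex.I).neg
  have hlim := tendsto_limUnder_of_hasDerivAt_of_integrableOn_Ioi (fun t _ => hderiv t) hderivInt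
  have hFTC := integral_Ioi_of_hasDerivAt_of_tendsto' (fun t _ => hderiv t) hderivInt hlim
  refine ⟨hintegrable.integrableOn, _, hlim, ?_, ?_⟩
  · rw [integral_neg, integral_smul] at hFTC
    simp only [hU1, one_mul, mul_one] at hFTC
    rw [sub_eq_add_neg, hFTC]
    abel
  · refine tendsto_nhds_unique (hlim.mul hlim) (hlim.congr fun t => ?_)
    have h := cauchyEvolution_mul hU1 hU2 hU3 t 0 t
    rw [hU1] at h
    calc U 0 t * p * U t 0 = U 0 t * (p * 1 * p) * U t 0 := by rw [mul_one, hp]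
      _ = U 0 t * p * U t 0 * (U 0 t * p * U t 0) := by
        rw [← h]
        simp only [mul_assoc]
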